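/- Let S be a set of states, A a nonempty set of actions, T : S × A → S a deterministic transition function, and r : S × A → ℝ a bounded reward function. Let 0 < γ_D < γ_{D-1} < ... < γ_0 < 1 and let w ∈ ℝ^{D+1} have all components nonnegative with w ≠ 0; set [f^n(η)](t) := Σ_{d=0}^D (Γ^n w)_d Φ_d(t). Then for every state s ∈ S: lim_{n→∞} V*_{f^n(η)}(s) / ‖Γ^n w‖ = V*(s), where ‖·‖ is the Euclidean norm on ℝ^{D+1} and V*(s) := sup over action sequences a : ℕ → A of Σ_{t=0}^∞ γ_0^t r(s_t, a_t). -/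

import Mathlib

/-- `Phi γ d t = Σ_{(a_0,...,a_d) ∈ ℕ^{d+1}, a_0+...+a_d = t} ∏_{i=0}^{d} γ_i^{a_i}`. -/
noncomputable def Phi (γ : ℕ → ℝ) (d t : ℕ) : ℝ :=
  ∑ a ∈ Finset.Nat.antidiagonalTuple (d + 1) t, ∏ i : Fin (d + 1), γ i ^ a i

/-- `Gam γ D` is the (D+1)×(D+1) matrix with `Γ_{ij} = γ_i` if `i ≤ j`, else `0`. -/
def Gam (γ : ℕ → ℝ) (D : ℕ) : Matrix (Fin (D + 1)) (Fin (D + 1)) ℝ :=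
  Matrix.of fun i j => if i ≤ j then γ i else 0

/-- Deterministic trajectory: `s_0 = s`, `s_{t+1} = T(s_t, a_t)`. -/
def traj {S A : Type*} (T : S → A → S) (s : S) (a : ℕ → A) : ℕ → S
  | 0 => s
  | t + 1 => T (traj T s a t) (a t)

/-- Optimal value for weights `η`: sup over action sequences of `Σ_t η(t) r(s_t, a_t)`. -/
noncomputable def Vstar {S A : Type*} (T : S → A → S) (r : S → A → ℝ) (η : ℕ → ℝ) (s : S) : ℝ :=
  ⨆ a : ℕ → A, ∑' t, η t * r (traj T s a t) (a t)

/-- Euclidean norm on `ℝ^m`. -/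
noncomputable def eucNorm {m : ℕ} (v : Fin m → ℝ) : ℝ := Real.sqrt (∑ d, v d ^ 2)

theorem phi_zero (γ : ℕ → ℝ) (t : ℕ) : Phi γ 0 t = γ 0 ^ t := by
  unfold Phi
  rw [Finset.Nat.antidiagonalTuple_one, Finset.sum_singleton, Fin.prod_univ_one]
  rfl

theorem sum_antidiagonalTuple_succ_prod_pow {R : Type*} [CommSemiring R] {k : ℕ}
    (c : Fin (k + 1) → R) (t : ℕ) :
    ∑ a ∈ Finset.Nat.antidiagonalTuple (k + 1) t, ∏ i, c i ^ a i =
      ∑ p ∈ Finset.HasAntidiagonal.antidiagonal t, c 0 ^ p.1 *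
        ∑ b ∈ Finset.Nat.antidiagonalTuple k p.2, ∏ i, c i.succ ^ b i := by
  simp_rw [Finset.mul_sum]
  rw [Finset.sum_sigma']
  refine Finset.sum_bij' (fun a _ => ⟨(a 0, ∑ i : Fin k, a i.succ), Fin.tail a⟩)
    (fun x _ => Fin.cons x.1.1 x.2) ?_ ?_ ?_ ?_ ?_
  · intro a ha
    simp only [Finset.Nat.mem_antidiagonalTuple, Fin.sum_univ_succ] at ha
    simp [Finset.Nat.mem_antidiagonalTuple, Fin.tail, ha]
  · rintro ⟨⟨p, q⟩, b⟩ hx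
    simp only [Finset.mem_sigma, Finset.HasAntidiagonal.mem_antidiagonal,
      Finset.Nat.mem_antidiagonalTuple] at hx
    simp [Finset.Nat.mem_antidiagonalTuple, Fin.sum_univ_succ, hx.1, hx.2]
  · intro a _
    simp
  · rintro ⟨⟨p, q⟩, b⟩ hx
    simp only [Finset.mem_sigma, Finset.HasAntidiagonal.mem_antidiagonal,
      Finset.Nat.mem_antidiagonalTuple] at hx
    simp [hx.2]
  · intro a _
    simp [Fin.prod_univ_succ, Fin.tail]

theorem summable_abs_sum_antidiagonalTuple_prod_pow {k : ℕ} (c : Fin k → ℝ)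
    (hc : ∀ i, |c i| < 1) :
    Summable fun t => |∑ a ∈ Finset.Nat.antidiagonalTuple k t, ∏ i, c i ^ a i| := by
  induction k with
  | zero =>
    refine summable_of_ne_finset_zero (s := {0}) fun t ht => ?_
    obtain ⟨m, rfl⟩ := Nat.exists_eq_succ_of_ne_zero (Finset.notMem_singleton.1 ht)
    simp
  | succ k ih =>
    simp_rw [sum_antidiagonalTuple_succ_prod_pow]
    refine summable_norm_sum_mul_antidiagonal_of_summable_norm (f := fun t => c 0 ^ t)
      (g := fun t => ∑ b ∈ Finset.Nat.antidiagonalTuple k t, ∏ i, c i.succ ^ b i) ?_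
      (ih (fun i => c i.succ) fun i => hc i.succ)
    simpa [abs_pow] using summable_geometric_of_lt_one (abs_nonneg (c 0)) (hc 0)

section Vstar

variable {S A : Type*} (T : S → A → S) (r : S → A → ℝ)

theorem vstar_mul {c : ℝ} (hc : 0 ≤ c) (η : ℕ → ℝ) (s : S) :
    Vstar T r (fun t => c * η t) s = c * Vstar T r η s := by
  unfold Vstar
  rw [Real.mul_iSup_of_nonneg hc]
  simp_rw [mul_assoc, tsum_mul_left]

variable {r} {C : ℝ}

theorem summable_mul_reward (hC : ∀ s a, |r s a| ≤ C)
    {η : ℕ → ℝ} (hη : Summable fun t => |η t|) (s : S) (a : ℕ → A) :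
    Summable fun t => η t * r (traj T s a t) (a t) := by
  refine Summable.of_norm_bounded (hη.mul_right C) fun t => ?_
  rw [Real.norm_eq_abs, abs_mul]
  exact mul_le_mul_of_nonneg_left (hC _ _) (abs_nonneg _)

theorem abs_tsum_mul_reward_le (hC : ∀ s a, |r s a| ≤ C)
    {η : ℕ → ℝ} (hη : Summable fun t => |η t|) (s : S) (a : ℕ → A) :
    |∑' t, η t * r (traj T s a t) (a t)| ≤ (∑' t, |η t|) * C := by
  rw [← Real.norm_eq_abs]
  refine tsum_of_norm_bounded (hη.hasSum.mul_right C) fun t => ?_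
  rw [Real.norm_eq_abs, abs_mul]
  exact mul_le_mul_of_nonneg_left (hC _ _) (abs_nonneg _)

theorem vstar_le_add (hC : ∀ s a, |r s a| ≤ C)
    [Nonempty A] {η η' : ℕ → ℝ} (hη : Summable fun t => |η t|)
    (hη' : Summable fun t => |η' t|) (s : S) :
    Vstar T r η s ≤ Vstar T r η' s + (∑' t, |η t - η' t|) * C := by
  refine ciSup_le fun a => ?_
  have hsub : Summable fun t => |η t - η' t| := (hη.of_abs.sub hη'.of_abs).abs
  have hbdd : BddAbove (Set.range fun a : ℕ → A => ∑' t, η' t * r (traj T s a t) (a t)) := by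
    refine ⟨(∑' t, |η' t|) * C, ?_⟩
    rintro _ ⟨b, rfl⟩
    exact (le_abs_self _).trans (abs_tsum_mul_reward_le T hC hη' s b)
  have hle := le_ciSup hbdd a
  have hdiff := (le_abs_self _).trans (abs_tsum_mul_reward_le T hC hsub s a)
  simp_rw [sub_mul] at hdiff
  rw [(summable_mul_reward T hC hη s a).tsum_sub (summable_mul_reward T hC hη' s a)] at hdiff
  unfold Vstar
  linarith

theorem abs_vstar_sub_le (hC : ∀ s a, |r s a| ≤ C)
    [Nonempty A] {η η' : ℕ → ℝ} (hη : Summable fun t => |η t|)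
    (hη' : Summable fun t => |η' t|) (s : S) :
    |Vstar T r η s - Vstar T r η' s| ≤ (∑' t, |η t - η' t|) * C := by
  have h₁ := vstar_le_add T hC hη hη' s
  have h₂ := vstar_le_add T hC hη' hη s
  simp_rw [abs_sub_comm (η' _)] at h₂
  rw [abs_le]
  constructor <;> linarith

theorem tendsto_vstar_sum (hC : ∀ s a, |r s a| ≤ C)
    [Nonempty A] (s : S)
    {ι α : Type*} [Fintype ι] {l : Filter α}
    (φ : ι → ℕ → ℝ) (hφ : ∀ i, Summable fun t => |φ i t|) {p : α → ι → ℝ} {q : ι → ℝ}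
    (hp : Filter.Tendsto p l (nhds q)) :
    Filter.Tendsto (fun n => Vstar T r (fun t => ∑ i, p n i * φ i t) s) l
      (nhds (Vstar T r (fun t => ∑ i, q i * φ i t) s)) := by
  have hsum : ∀ v : ι → ℝ, Summable fun t => |∑ i, v i * φ i t| := fun v =>
    (summable_sum fun i _ => (hφ i).of_abs.mul_left (v i)).abs
  have hC0 : 0 ≤ C := (abs_nonneg _).trans (hC s (Classical.arbitrary A))
  have hbound : ∀ n, ∑' t, |(∑ i, p n i * φ i t) - ∑ i, q i * φ i t| ≤
      ∑ i, |p n i - q i| * ∑' t, |φ i t| := by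
    intro n
    have hs : HasSum (fun t => ∑ i, |p n i - q i| * |φ i t|)
        (∑ i, |p n i - q i| * ∑' t, |φ i t|) :=
      hasSum_sum fun i _ => (hφ i).hasSum.mul_left _
    refine (Summable.tsum_le_tsum (fun t => ?_)
      ((hsum (p n)).of_abs.sub (hsum q).of_abs).abs hs.summable).trans_eq hs.tsum_eq
    rw [← Finset.sum_sub_distrib]
    refine (Finset.abs_sum_le_sum_abs _ _).trans_eq (Finset.sum_congr rfl fun i _ => ?_)
    rw [← sub_mul, abs_mul]
  have hzero : Filter.Tendsto (fun n => (∑ i, |p n i - q i| * ∑' t, |φ i t|) * C) l (nhds 0) := by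
    have h : Filter.Tendsto (fun n => (∑ i, |p n i - q i| * ∑' t, |φ i t|) * C) l
        (nhds ((∑ i, |q i - q i| * ∑' t, |φ i t|) * C)) :=
      (tendsto_finsetSum _ fun i _ =>
        (((tendsto_pi_nhds.1 hp i).sub_const _).abs).mul_const _).mul_const _
    simpa using h
  rw [tendsto_iff_dist_tendsto_zero]
  refine squeeze_zero (fun _ => dist_nonneg) (fun n => ?_) hzero
  rw [Real.dist_eq]
  exact (abs_vstar_sub_le T hC (hsum (p n)) (hsum q) s).trans
    (mul_le_mul_of_nonneg_right (hbound n) hC0)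

end Vstar

theorem tendsto_div_eucNorm {m : ℕ} {v : ℕ → Fin m → ℝ} {i : Fin m}
    (hpos : ∀ᶠ n in Filter.atTop, 0 < v n i)
    (hv : ∀ j ≠ i, Filter.Tendsto (fun n => v n j / v n i) Filter.atTop (nhds 0)) :
    Filter.Tendsto (fun n j => v n j / eucNorm (v n)) Filter.atTop (nhds (Pi.single i 1)) := by
  have hu : Filter.Tendsto (fun n j => v n j / v n i) Filter.atTop (nhds (Pi.single i 1)) := by
    refine tendsto_pi_nhds.2 fun j => ?_
    rcases eq_or_ne j i with rfl | hj
    · rw [Pi.single_eq_same]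
      refine tendsto_const_nhds.congr' ?_
      filter_upwards [hpos] with n hn
      rw [div_self hn.ne']
    · rw [Pi.single_eq_of_ne hj]
      exact hv j hj
  have hcont : Continuous (eucNorm : (Fin m → ℝ) → ℝ) := by
    unfold eucNorm
    fun_prop
  have hsingle : eucNorm (Pi.single i 1 : Fin m → ℝ) = 1 := by
    simp [eucNorm, Pi.single_apply]
  have hnorm : Filter.Tendsto (fun n => eucNorm fun j => v n j / v n i) Filter.atTop (nhds 1) :=
    hsingle ▸ (hcont.tendsto _).comp hu
  refine tendsto_pi_nhds.2 fun j => ?_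
  have hj := (tendsto_pi_nhds.1 hu j).div hnorm one_ne_zero
  rw [div_one] at hj
  refine hj.congr' ?_
  filter_upwards [hpos] with n hn
  have hscale : eucNorm (fun j => v n j / v n i) = eucNorm (v n) / v n i := by
    unfold eucNorm
    simp_rw [div_pow]
    rw [← Finset.sum_div, Real.sqrt_div' _ (sq_nonneg _), Real.sqrt_sq hn.le]
  simp only [Pi.div_apply, hscale]
  rw [div_div_div_cancel_right₀ hn.ne']

section Gam

variable {γ : ℕ → ℝ} {D : ℕ} {w : Fin (D + 1) → ℝ}

theorem gam_mulVec (γ : ℕ → ℝ) (D : ℕ) (v : Fin (D + 1) → ℝ) (i : Fin (D + 1)) :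
    (Gam γ D).mulVec v i = γ i * ∑ j, if i ≤ j then v j else 0 := by
  simp [Gam, Matrix.mulVec, dotProduct, Finset.mul_sum]

theorem gam_pow_succ_mulVec (γ : ℕ → ℝ) (D : ℕ) (w : Fin (D + 1) → ℝ) (n : ℕ)
    (i : Fin (D + 1)) :
    (Gam γ D ^ (n + 1)).mulVec w i =
      γ i * ∑ j, if i ≤ j then (Gam γ D ^ n).mulVec w j else 0 := by
  rw [pow_succ', ← Matrix.mulVec_mulVec, gam_mulVec]

theorem gam_pow_mulVec_nonneg (hpos : ∀ d ≤ D, 0 < γ d) (hw : ∀ d, 0 ≤ w d) (n : ℕ)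
    (i : Fin (D + 1)) : 0 ≤ (Gam γ D ^ n).mulVec w i := by
  induction n generalizing i with
  | zero => simpa using hw i
  | succ n ih =>
    rw [gam_pow_succ_mulVec]
    refine mul_nonneg (hpos i (by omega)).le (Finset.sum_nonneg fun j _ => ?_)
    split_ifs
    exacts [ih j, le_rfl]

theorem le_sum_gam_pow_mulVec (hpos : ∀ d ≤ D, 0 < γ d) (hw : ∀ d, 0 ≤ w d) (n : ℕ) :
    γ 0 ^ n * ∑ d, w d ≤ ∑ d, (Gam γ D ^ n).mulVec w d := by
  induction n with
  | zero => simp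
  | succ n ih =>
    have h0 := gam_pow_succ_mulVec γ D w n 0
    simp only [Fin.zero_le, if_true, Fin.val_zero] at h0
    have hle := Finset.single_le_sum
      (fun d _ => gam_pow_mulVec_nonneg hpos hw (n + 1) d) (Finset.mem_univ 0)
    have hmul := mul_le_mul_of_nonneg_left ih (hpos 0 (Nat.zero_le D)).le
    rw [pow_succ', mul_assoc]
    linarith

theorem le_gam_pow_succ_mulVec_zero (hpos : ∀ d ≤ D, 0 < γ d) (hw : ∀ d, 0 ≤ w d) (n : ℕ) :
    γ 0 ^ (n + 1) * ∑ d, w d ≤ (Gam γ D ^ (n + 1)).mulVec w 0 := by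
  rw [gam_pow_succ_mulVec, pow_succ', mul_assoc]
  simpa using mul_le_mul_of_nonneg_left (le_sum_gam_pow_mulVec hpos hw n)
    (hpos 0 (Nat.zero_le D)).le

theorem sum_ite_le_geom {ε : ℝ} (hε : 0 ≤ ε) (hε1 : ε < 1) (N : ℕ) (i : Fin N) :
    (∑ j : Fin N, if i ≤ j then ε ^ (j : ℕ) else 0) ≤ ε ^ (i : ℕ) / (1 - ε) := by
  have h := Fin.sum_univ_eq_sum_range (fun j => if (i : ℕ) ≤ j then ε ^ j else 0) N
  simp only [Fin.val_fin_le] at h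
  rw [h, ← Finset.sum_filter]
  refine le_trans (le_of_eq ?_) (geom_sum_Ico_le_of_lt_one (m := (i : ℕ)) (n := N) hε hε1)
  congr 1
  ext j
  simp [and_comm]

theorem gam_pow_mulVec_le {g ε M : ℝ} (hg0 : 0 ≤ g) (hg : ∀ d, 1 ≤ d → d ≤ D → γ d ≤ g)
    (hpos : ∀ d ≤ D, 0 < γ d) (hw : ∀ d, 0 ≤ w d) (hε : 0 ≤ ε) (hε1 : ε < 1) (hM : 0 ≤ M)
    (hwM : ∀ d : Fin (D + 1), w d ≤ M * ε ^ (d : ℕ)) (n : ℕ) (i : Fin (D + 1)) (hi : i ≠ 0) :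
    (Gam γ D ^ n).mulVec w i ≤ M * ε ^ (i : ℕ) * (g / (1 - ε)) ^ n := by
  induction n generalizing i with
  | zero => simpa using hwM i
  | succ n ih =>
    have hρ : 0 ≤ g / (1 - ε) := div_nonneg hg0 (sub_pos.2 hε1).le
    have hsum : (∑ j, if i ≤ j then (Gam γ D ^ n).mulVec w j else 0) ≤
        M * (g / (1 - ε)) ^ n * (ε ^ (i : ℕ) / (1 - ε)) := by
      refine le_trans ?_ (mul_le_mul_of_nonneg_left (sum_ite_le_geom hε hε1 _ i)
        (mul_nonneg hM (pow_nonneg hρ n)))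
      rw [Finset.mul_sum]
      refine Finset.sum_le_sum fun j _ => ?_
      split_ifs with hij
      · have hj : j ≠ 0 := fun h => hi (Fin.le_zero_iff.1 (h ▸ hij))
        linarith [ih j hj]
      · simp
    have hnn : 0 ≤ ∑ j, if i ≤ j then (Gam γ D ^ n).mulVec w j else 0 :=
      Finset.sum_nonneg fun j _ => by
        split_ifs
        exacts [gam_pow_mulVec_nonneg hpos hw n j, le_rfl]
    have hi1 : 1 ≤ (i : ℕ) := Nat.one_le_iff_ne_zero.2 fun h => hi (Fin.ext h)
    rw [gam_pow_succ_mulVec]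
    calc _ ≤ g * (M * (g / (1 - ε)) ^ n * (ε ^ (i : ℕ) / (1 - ε))) :=
          mul_le_mul (hg i hi1 (by omega)) hsum hnn hg0
      _ = _ := by ring

theorem tendsto_normalized_gam_pow_mulVec (hpos : ∀ d ≤ D, 0 < γ d)
    (hmono : ∀ i j, i < j → j ≤ D → γ j < γ i) (hw : ∀ d, 0 ≤ w d) (hw_pos : 0 < ∑ d, w d) :
    Filter.Tendsto
      (fun n d => (Gam γ D ^ n).mulVec w d / eucNorm ((Gam γ D ^ n).mulVec w))
      Filter.atTop (nhds (Pi.single 0 1)) := by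
  have h0 : 0 < γ 0 := hpos 0 (Nat.zero_le D)
  have hlower : ∀ n, 1 ≤ n → γ 0 ^ n * ∑ d, w d ≤ (Gam γ D ^ n).mulVec w 0 := by
    intro n hn
    obtain ⟨m, rfl⟩ := Nat.exists_eq_add_of_le' hn
    exact le_gam_pow_succ_mulVec_zero hpos hw m
  have hlower_pos : ∀ n, 0 < γ 0 ^ n * ∑ d, w d := fun n => mul_pos (pow_pos h0 n) hw_pos
  obtain ⟨g, hg0, hgγ, hg⟩ : ∃ g, 0 ≤ g ∧ g < γ 0 ∧ ∀ d, 1 ≤ d → d ≤ D → γ d ≤ g := by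
    rcases Nat.eq_zero_or_pos D with hD | hD
    · exact ⟨0, le_rfl, h0, fun d h1 h2 => by omega⟩
    · refine ⟨γ 1, (hpos 1 hD).le, hmono 0 1 one_pos hD, fun d h1 h2 => ?_⟩
      rcases h1.eq_or_lt with rfl | h
      · exact le_rfl
      · exact (hmono 1 d h h2).le
  obtain ⟨ε, hε, hε1, hgε⟩ : ∃ ε : ℝ, 0 < ε ∧ ε < 1 ∧ g < γ 0 * (1 - ε) := by
    refine ⟨(γ 0 - g) / (2 * γ 0), div_pos (by linarith) (by linarith), ?_, ?_⟩
    · rw [div_lt_one (by linarith)]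
      linarith
    · have : γ 0 * (1 - (γ 0 - g) / (2 * γ 0)) = (γ 0 + g) / 2 := by
        field_simp
        ring
      linarith
  have hterm : ∀ d : Fin (D + 1), 0 ≤ w d / ε ^ (d : ℕ) := fun d =>
    div_nonneg (hw d) (pow_nonneg hε.le _)
  set M := ∑ d : Fin (D + 1), w d / ε ^ (d : ℕ) with hMdef
  have hM : 0 ≤ M := Finset.sum_nonneg fun d _ => hterm d
  have hwM : ∀ d : Fin (D + 1), w d ≤ M * ε ^ (d : ℕ) := fun d =>
    (div_le_iff₀ (pow_pos hε _)).1
      (Finset.single_le_sum (fun d _ => hterm d) (Finset.mem_univ d))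
  have hρ0 : 0 ≤ g / (1 - ε) / γ 0 := div_nonneg (div_nonneg hg0 (sub_pos.2 hε1).le) h0.le
  have hρ1 : g / (1 - ε) / γ 0 < 1 := by
    rw [div_lt_one h0, div_lt_iff₀ (sub_pos.2 hε1)]
    exact hgε
  refine tendsto_div_eucNorm ?_ fun d hd => ?_
  · filter_upwards [Filter.eventually_ge_atTop 1] with n hn
    exact (hlower_pos n).trans_le (hlower n hn)
  · have hlim : Filter.Tendsto
        (fun n : ℕ => M * ε ^ (d : ℕ) / (∑ d, w d) * (g / (1 - ε) / γ 0) ^ n)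
        Filter.atTop (nhds 0) := by
      simpa using (tendsto_pow_atTop_nhds_zero_of_lt_one hρ0 hρ1).const_mul
        (M * ε ^ (d : ℕ) / (∑ d, w d))
    refine squeeze_zero' (Filter.Eventually.of_forall fun n =>
      div_nonneg (gam_pow_mulVec_nonneg hpos hw n d) (gam_pow_mulVec_nonneg hpos hw n 0)) ?_ hlim
    filter_upwards [Filter.eventually_ge_atTop 1] with n hn
    have hupper := gam_pow_mulVec_le hg0 hg hpos hw hε.le hε1 hM hwM n d hd
    refine (div_le_div₀ ((gam_pow_mulVec_nonneg hpos hw n d).trans hupper) hupper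
      (hlower_pos n) (hlower n hn)).trans_eq ?_
    rw [div_pow _ (γ 0), mul_comm (γ 0 ^ n), mul_div_mul_comm]

end Gam

/-- deterministic-dynamics form of the rescaled-value convergence:
`lim_{n→∞} V*_{f^n(η)}(s) / ‖Γ^n w‖ = V*(s)`, where `[f^n(η)](t) = Σ_d (Γ^n w)_d Φ_d(t)`,
`‖·‖` is the Euclidean norm on `ℝ^{D+1}`, and `V*` is the γ_0-discounted optimal value. -/
theorem stmt13 {S A : Type*} [Nonempty A] (T : S → A → S) (r : S → A → ℝ)
    (hr : ∃ C, ∀ s a, |r s a| ≤ C)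
    (D : ℕ) (γ : ℕ → ℝ)
    (hpos : ∀ d ≤ D, 0 < γ d) (hlt : γ 0 < 1)
    (hmono : ∀ i j, i < j → j ≤ D → γ j < γ i)
    (w : Fin (D + 1) → ℝ) (hw : ∀ d, 0 ≤ w d) (hw0 : w ≠ 0) (s : S) :
    Filter.Tendsto
      (fun n : ℕ =>
        Vstar T r (fun t => ∑ d : Fin (D + 1), ((Gam γ D ^ n).mulVec w) d * Phi γ d t) s
          / eucNorm ((Gam γ D ^ n).mulVec w))
      Filter.atTop
      (nhds (Vstar T r (fun t => γ 0 ^ t) s)) := by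
  obtain ⟨C, hC⟩ := hr
  have hw_pos : 0 < ∑ d, w d := by
    obtain ⟨d, hd⟩ := Function.ne_iff.1 hw0
    exact Finset.sum_pos' (fun d _ => hw d)
      ⟨d, Finset.mem_univ d, lt_of_le_of_ne (hw d) (Ne.symm hd)⟩
  have hγ : ∀ d : Fin (D + 1), ∀ i : Fin (d + 1), |γ i| < 1 := by
    intro d i
    have hiD : (i : ℕ) ≤ D := by omega
    rw [abs_of_pos (hpos _ hiD)]
    rcases Nat.eq_zero_or_pos (i : ℕ) with h | h
    · rw [h]; exact hlt
    · exact (hmono 0 i h hiD).trans hlt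
  have hΦ : ∀ d : Fin (D + 1), Summable fun t => |Phi γ d t| := fun d =>
    summable_abs_sum_antidiagonalTuple_prod_pow _ (hγ d)
  have hlim := tendsto_normalized_gam_pow_mulVec hpos hmono hw hw_pos
  have hV := tendsto_vstar_sum T hC s (fun d t => Phi γ (d : Fin (D + 1)) t) hΦ hlim
  have hΦ0 : (fun t => ∑ d : Fin (D + 1), (Pi.single 0 1 : Fin (D + 1) → ℝ) d * Phi γ d t) =
      fun t => γ 0 ^ t := by
    funext t
    simp [Pi.single_apply, phi_zero]
  rw [hΦ0] at hV
  refine hV.congr fun n => ?_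
  have hnorm : 0 ≤ eucNorm ((Gam γ D ^ n).mulVec w) := Real.sqrt_nonneg _
  rw [div_eq_inv_mul, ← vstar_mul T r (inv_nonneg.2 hnorm)]
  congr 1
  funext t
  rw [Finset.mul_sum]
  refine Finset.sum_congr rfl fun d _ => ?_
  rw [div_eq_inv_mul, mul_assoc]
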